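/- Let u and ψ be entire functions on ℂ such that the weighted composition operator W_{(u,ψ)} is bounded on the Fock space 𝓕₂. Then W_{(u,ψ)} is not supercyclic on 𝓕₂; that is, there is no f ∈ 𝓕₂ for which the projective orbit {λ·W_{(u,ψ)}ⁿ f : λ ∈ ℂ, n ≥ 0} is dense in 𝓕₂. -/

import Mathlib

open MeasureTheory Finset

/-- Squared Fock-space norm: ‖f‖₂² = (1/π)∫_ℂ |f(z)|² e^{-|z|²} dA(z). -/
noncomputable def fockNormSq (f : ℂ → ℂ) : ℝ :=
  (1 / Real.pi) * ∫ z : ℂ, ‖f z‖ ^ 2 * Real.exp (-‖z‖ ^ 2)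

/-- Membership in the Fock space 𝓕₂: entire and square Gaussian-integrable. -/
def MemFock (f : ℂ → ℂ) : Prop :=
  Differentiable ℂ f ∧
  Integrable (fun z : ℂ => ‖f z‖ ^ 2 * Real.exp (-‖z‖ ^ 2))

/-- Fock-space inner product ⟨f,g⟩ = (1/π)∫_ℂ f(z)·conj(g(z))·e^{-|z|²} dA(z). -/
noncomputable def fockInner (f g : ℂ → ℂ) : ℂ :=
  (1 / (Real.pi : ℂ)) * ∫ z : ℂ, f z * (starRingEnd ℂ) (g z) * (Real.exp (-‖z‖ ^ 2) : ℂ)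

/-- Reproducing kernel of the Fock space: K_w(z) = e^{z·conj(w)}. -/
noncomputable def fockKernel (w : ℂ) : ℂ → ℂ :=
  fun z => Complex.exp (z * (starRingEnd ℂ) w)

/-- Weighted composition operator W_{(u,ψ)} f = u·(f∘ψ). -/
def wComp (u ψ : ℂ → ℂ) (f : ℂ → ℂ) : ℂ → ℂ := fun z => u z * f (ψ z)

/-- Composition operator C_ψ f = f∘ψ. -/
def compOp (ψ : ℂ → ℂ) (f : ℂ → ℂ) : ℂ → ℂ := fun z => f (ψ z)

/-- Multiplication operator M_u f = u·f. -/
def mulOp (u : ℂ → ℂ) (f : ℂ → ℂ) : ℂ → ℂ := fun z => u z * f z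

/-- T maps 𝓕₂ into 𝓕₂ and is bounded there. -/
def FockBoundedOp (T : (ℂ → ℂ) → ℂ → ℂ) : Prop :=
  (∀ f, MemFock f → MemFock (T f)) ∧
  ∃ C : ℝ, 0 ≤ C ∧ ∀ f, MemFock f → fockNormSq (T f) ≤ C * fockNormSq f

/-- f is a cyclic vector for T on 𝓕₂: the linear span of the orbit
{Tⁿ f : n ≥ 0} is dense in 𝓕₂. -/
def IsCyclicVec (T : (ℂ → ℂ) → ℂ → ℂ) (f : ℂ → ℂ) : Prop :=
  MemFock f ∧ ∀ g, MemFock g → ∀ ε : ℝ, 0 < ε →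
    ∃ (n : ℕ) (c : Fin n → ℂ),
      fockNormSq (fun z => (∑ i : Fin n, c i * T^[(i : ℕ)] f z) - g z) < ε

/-- T is cyclic on 𝓕₂. -/
def IsCyclicOp (T : (ℂ → ℂ) → ℂ → ℂ) : Prop := ∃ f, IsCyclicVec T f

/-- T is hypercyclic on 𝓕₂: some orbit {Tⁿ f : n ≥ 0} is dense. -/
def IsHypercyclicOp (T : (ℂ → ℂ) → ℂ → ℂ) : Prop :=
  ∃ f, MemFock f ∧ ∀ g, MemFock g → ∀ ε : ℝ, 0 < ε →
    ∃ n : ℕ, fockNormSq (fun z => T^[n] f z - g z) < ε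

/-- T is supercyclic on 𝓕₂: some projective orbit {λTⁿ f} is dense. -/
def IsSupercyclicOp (T : (ℂ → ℂ) → ℂ → ℂ) : Prop :=
  ∃ f, MemFock f ∧ ∀ g, MemFock g → ∀ ε : ℝ, 0 < ε →
    ∃ (lam : ℂ) (n : ℕ), fockNormSq (fun z => lam * T^[n] f z - g z) < ε

/-- T is invertible as a bounded operator on 𝓕₂. -/
def FockOpInvertible (T : (ℂ → ℂ) → ℂ → ℂ) : Prop :=
  (∀ f, MemFock f → MemFock (T f)) ∧
  ∃ S : (ℂ → ℂ) → ℂ → ℂ,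
    (∀ f, MemFock f → MemFock (S f)) ∧
    (∀ f, MemFock f → S (T f) = f) ∧
    (∀ f, MemFock f → T (S f) = f) ∧
    ∃ C : ℝ, 0 ≤ C ∧ ∀ f, MemFock f → fockNormSq (S f) ≤ C * fockNormSq f

/-- μ is an eigenvalue of the Hilbert-space adjoint W_{(u,ψ)}*, expressed via the
inner product: W* g = μ g for a nonzero g ∈ 𝓕₂, i.e. ⟨Wf, g⟩ = conj(μ)·⟨f, g⟩
for all f ∈ 𝓕₂. -/
def IsAdjointEigenvalue (u ψ : ℂ → ℂ) (μ : ℂ) : Prop :=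
  ∃ g, MemFock g ∧ g ≠ 0 ∧ ∀ f, MemFock f →
    fockInner (wComp u ψ f) g = (starRingEnd ℂ) μ * fockInner f g

theorem integral_exp_neg_norm_sq : ∫ z : ℂ, Real.exp (-‖z‖ ^ 2) = Real.pi := by
  have := GaussianFourier.integral_rexp_neg_mul_sq_norm (V := ℂ) (b := 1) one_pos
  simpa using this

theorem circleMap_mul_measurePreserving (θ : ℝ) :
    MeasurePreserving (fun z : ℂ => circleMap 0 1 θ * z) volume volume := by
  have h : MeasurePreserving (rotation (Circle.exp θ)) (volume : Measure ℂ) volume :=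
    LinearIsometryEquiv.measurePreserving _
  convert h using 1
  ext z
  simp [circleMap]

/-- Gaussian mean value property of entire functions. -/
theorem integral_mul_gaussian_eq {G : ℂ → ℂ} (hG : Differentiable ℂ G)
    (hi : Integrable (fun z : ℂ => G z * (Real.exp (-‖z‖ ^ 2) : ℂ))) :
    ∫ z : ℂ, G z * (Real.exp (-‖z‖ ^ 2) : ℂ) = Real.pi * G 0 := by
  set F : ℂ → ℂ := fun z => G z * (Real.exp (-‖z‖ ^ 2) : ℂ) with hF
  set c : ℝ → ℂ := circleMap 0 1 with hc
  have hcn : ∀ θ, ‖c θ‖ = 1 := fun θ => by simp [hc]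
  have hFc : Continuous F := by
    have := hG.continuous
    fun_prop
  have hcc : Continuous c := continuous_circleMap 0 1
  have hmp : ∀ θ, MeasurePreserving (fun z : ℂ => c θ * z) volume volume :=
    circleMap_mul_measurePreserving
  have hme : ∀ θ, MeasurableEmbedding (fun z : ℂ => c θ * z) := fun θ =>
    measurableEmbedding_mulLeft₀ (norm_ne_zero_iff.1 (by simp [hcn]))
  have hrot : ∀ θ, ∫ z, F (c θ * z) = ∫ z, F z := fun θ => (hmp θ).integral_comp (hme θ) F
  have hrotn : ∀ θ, ∫ z, ‖F (c θ * z)‖ = ∫ z, ‖F z‖ :=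
    fun θ => (hmp θ).integral_comp (hme θ) fun z => ‖F z‖
  have hint : Integrable (Function.uncurry fun (θ : ℝ) (z : ℂ) => F (c θ * z))
      ((volume.restrict (Set.uIoc 0 (2 * Real.pi))).prod volume) := by
    rw [integrable_prod_iff (by
      apply Continuous.aestronglyMeasurable
      unfold Function.uncurry
      fun_prop)]
    refine ⟨.of_forall fun θ => (hmp θ).integrable_comp_of_integrable hi, ?_⟩
    simp only [Function.uncurry, hrotn]
    rw [Set.uIoc_of_le (by positivity)]
    exact integrable_const _
  have hswap := intervalIntegral_integral_swap (a := 0) (b := 2 * Real.pi) hint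
  simp only [hrot] at hswap
  have hmean : ∀ z : ℂ, ∫ θ in (0 : ℝ)..2 * Real.pi, F (c θ * z) =
      (2 * Real.pi) * (G 0 * (Real.exp (-‖z‖ ^ 2) : ℂ)) := by
    intro z
    have h := DiffContOnCl.circleAverage (f := fun w => G (w * z)) (c := 0) (R := 1)
      (Differentiable.diffContOnCl (by fun_prop))
    rw [Real.circleAverage_def] at h
    have h2 : ∫ θ in (0 : ℝ)..2 * Real.pi, G (c θ * z) = 2 * Real.pi * G 0 := by
      simp only [zero_mul] at h
      change (2 * Real.pi)⁻¹ • ∫ θ in (0 : ℝ)..2 * Real.pi, G (c θ * z) = G 0 at h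
      rw [← h, Complex.real_smul]
      push_cast
      rw [mul_inv_cancel_left₀ (by simp [Real.pi_ne_zero])]
    have h3 : ∀ θ, F (c θ * z) = G (c θ * z) * (Real.exp (-‖z‖ ^ 2) : ℂ) := by
      intro θ
      simp [hF, hcn]
    simp only [h3, intervalIntegral.integral_mul_const, h2]
    ring
  simp only [hmean] at hswap
  have hgauss : ∫ z : ℂ, (Real.exp (-‖z‖ ^ 2) : ℂ) = Real.pi := by
    rw [integral_complex_ofReal, integral_exp_neg_norm_sq]
  rw [intervalIntegral.integral_const, integral_const_mul, integral_const_mul, hgauss,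
    Complex.real_smul] at hswap
  have hpi : (Real.pi : ℂ) ≠ 0 := by exact_mod_cast Real.pi_ne_zero
  push_cast at hswap
  simp only [sub_zero] at hswap
  have h4 := mul_left_cancel₀ (mul_ne_zero two_ne_zero hpi) hswap
  rw [h4]
  ring

/-- A function times the square root of the Gaussian weight. -/
noncomputable def gaussWeighted (h : ℂ → ℂ) : ℂ → ℂ :=
  fun z => h z * (Real.exp (-‖z‖ ^ 2 / 2) : ℂ)

theorem norm_gaussWeighted_sq (h : ℂ → ℂ) (z : ℂ) :
    ‖gaussWeighted h z‖ ^ 2 = ‖h z‖ ^ 2 * Real.exp (-‖z‖ ^ 2) := by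
  rw [gaussWeighted, norm_mul, mul_pow, Complex.norm_real, Real.norm_of_nonneg (Real.exp_nonneg _),
    ← Real.exp_nat_mul]
  congr 2
  push_cast
  ring

theorem memFock_iff_memLp {h : ℂ → ℂ} :
    MemFock h ↔ Differentiable ℂ h ∧ MemLp (gaussWeighted h) 2 := by
  refine and_congr_right fun hd => ?_
  have hc : Continuous (gaussWeighted h) := by
    have := hd.continuous
    unfold gaussWeighted
    fun_prop
  rw [memLp_two_iff_integrable_sq_norm hc.aestronglyMeasurable]
  simp only [norm_gaussWeighted_sq]

theorem MemFock.add {f g : ℂ → ℂ} (hf : MemFock f) (hg : MemFock g) :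
    MemFock (fun z => f z + g z) := by
  rw [memFock_iff_memLp] at *
  refine ⟨hf.1.add hg.1, ?_⟩
  convert hf.2.add hg.2 using 1
  ext z
  simp [gaussWeighted, add_mul]

theorem MemFock.const_mul {f : ℂ → ℂ} (hf : MemFock f) (c : ℂ) :
    MemFock (fun z => c * f z) := by
  rw [memFock_iff_memLp] at *
  refine ⟨hf.1.const_mul c, ?_⟩
  convert hf.2.const_mul c using 1
  ext z
  simp [gaussWeighted, mul_assoc]

theorem MemFock.sub {f g : ℂ → ℂ} (hf : MemFock f) (hg : MemFock g) :
    MemFock (fun z => f z - g z) := by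
  simpa [sub_eq_add_neg] using hf.add (hg.const_mul (-1))

theorem fockNormSq_nonneg (f : ℂ → ℂ) : 0 ≤ fockNormSq f := by
  unfold fockNormSq
  have := integral_nonneg (μ := (volume : Measure ℂ))
    (f := fun z : ℂ => ‖f z‖ ^ 2 * Real.exp (-‖z‖ ^ 2)) fun z => by positivity
  positivity

theorem fockNormSq_const_mul (c : ℂ) (f : ℂ → ℂ) :
    fockNormSq (fun z => c * f z) = ‖c‖ ^ 2 * fockNormSq f := by
  simp only [fockNormSq, norm_mul, mul_pow, mul_assoc, integral_const_mul]
  ring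

/-- The Fock-space norm. -/
noncomputable def fockNorm (f : ℂ → ℂ) : ℝ := √(fockNormSq f)

theorem fockNorm_nonneg (f : ℂ → ℂ) : 0 ≤ fockNorm f := Real.sqrt_nonneg _

theorem fockNorm_sq (f : ℂ → ℂ) : fockNorm f ^ 2 = fockNormSq f :=
  Real.sq_sqrt (fockNormSq_nonneg f)

theorem fockNorm_const_mul (c : ℂ) (f : ℂ → ℂ) :
    fockNorm (fun z => c * f z) = ‖c‖ * fockNorm f := by
  rw [fockNorm, fockNormSq_const_mul, Real.sqrt_mul (by positivity), Real.sqrt_sq (norm_nonneg c),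
    fockNorm]

theorem fockNorm_eq_eLpNorm {f : ℂ → ℂ} (hf : MemFock f) :
    fockNorm f = √(1 / Real.pi) * (eLpNorm (gaussWeighted f) 2 volume).toReal := by
  rw [(memFock_iff_memLp.1 hf).2.eLpNorm_eq_integral_rpow_norm two_ne_zero ENNReal.ofNat_ne_top,
    ENNReal.toReal_ofReal (by positivity), fockNorm, fockNormSq, Real.sqrt_mul (by positivity)]
  simp only [ENNReal.toReal_ofNat, Real.rpow_ofNat, norm_gaussWeighted_sq]
  rw [Real.sqrt_eq_rpow, Real.sqrt_eq_rpow, one_div (2 : ℝ)]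

theorem fockNorm_add_le {f g : ℂ → ℂ} (hf : MemFock f) (hg : MemFock g) :
    fockNorm (fun z => f z + g z) ≤ fockNorm f + fockNorm g := by
  rw [fockNorm_eq_eLpNorm hf, fockNorm_eq_eLpNorm hg, fockNorm_eq_eLpNorm (hf.add hg), ← mul_add]
  have hf' := (memFock_iff_memLp.1 hf).2
  have hg' := (memFock_iff_memLp.1 hg).2
  gcongr
  rw [← ENNReal.toReal_add hf'.eLpNorm_ne_top hg'.eLpNorm_ne_top]
  refine ENNReal.toReal_mono (ENNReal.add_ne_top.2 ⟨hf'.eLpNorm_ne_top, hg'.eLpNorm_ne_top⟩) ?_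
  convert eLpNorm_add_le hf'.1 hg'.1 one_le_two using 2
  ext z
  simp [gaussWeighted, add_mul]

theorem fockNorm_sub_le {f g : ℂ → ℂ} (hf : MemFock f) (hg : MemFock g) :
    fockNorm (fun z => f z - g z) ≤ fockNorm f + fockNorm g := by
  have h := fockNorm_add_le hf (hg.const_mul (-1))
  rw [fockNorm_const_mul, norm_neg, norm_one, one_mul] at h
  simpa [sub_eq_add_neg] using h

theorem memFock_one : MemFock fun _ => 1 := by
  refine ⟨by fun_prop, ?_⟩
  by_contra h
  simp only [norm_one, one_pow, one_mul] at h
  exact Real.pi_ne_zero (integral_exp_neg_norm_sq.symm.trans (integral_undef h))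

theorem fockNormSq_one : fockNormSq (fun _ => 1) = 1 := by
  simp [fockNormSq, integral_exp_neg_norm_sq, Real.pi_ne_zero]

/-- The (unnormalized) Weyl translation `h ↦ e^{-z b̄} h(z + b)`. -/
noncomputable def weylShift (b : ℂ) (h : ℂ → ℂ) : ℂ → ℂ :=
  fun z => Complex.exp (-(z * (starRingEnd ℂ) b)) * h (z + b)

theorem norm_weylShift_sq_mul (b : ℂ) (h : ℂ → ℂ) (z : ℂ) :
    ‖weylShift b h z‖ ^ 2 * Real.exp (-‖z‖ ^ 2) =
      Real.exp (‖b‖ ^ 2) * (‖h (z + b)‖ ^ 2 * Real.exp (-‖z + b‖ ^ 2)) := by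
  have hn : ‖z + b‖ ^ 2 = ‖z‖ ^ 2 + ‖b‖ ^ 2 + 2 * (z * (starRingEnd ℂ) b).re := by
    simp only [← Complex.normSq_eq_norm_sq, Complex.normSq_add]
  rw [weylShift, norm_mul, mul_pow, Complex.norm_exp, ← Real.exp_nat_mul, hn,
    mul_right_comm, ← Real.exp_add, mul_left_comm, ← Real.exp_add, mul_comm]
  congr 2
  simp only [Complex.neg_re]
  push_cast
  ring

theorem fockNormSq_weylShift (b : ℂ) (h : ℂ → ℂ) :
    fockNormSq (weylShift b h) = Real.exp (‖b‖ ^ 2) * fockNormSq h := by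
  simp only [fockNormSq, norm_weylShift_sq_mul, integral_const_mul]
  rw [integral_add_right_eq_self (fun z : ℂ => ‖h z‖ ^ 2 * Real.exp (-‖z‖ ^ 2)) b]
  ring

theorem MemFock.weylShift {h : ℂ → ℂ} (hh : MemFock h) (b : ℂ) : MemFock (weylShift b h) := by
  refine ⟨?_, ?_⟩
  · have := hh.1
    unfold _root_.weylShift
    fun_prop
  · simp only [norm_weylShift_sq_mul]
    exact (hh.2.comp_add_right b).const_mul _

theorem norm_apply_zero_sq_le {h : ℂ → ℂ} (hh : MemFock h) : ‖h 0‖ ^ 2 ≤ fockNormSq h := by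
  have hd := hh.1
  have hn : ∀ z : ℂ, ‖h z ^ 2 * (Real.exp (-‖z‖ ^ 2) : ℂ)‖ = ‖h z‖ ^ 2 * Real.exp (-‖z‖ ^ 2) := by
    intro z
    rw [norm_mul, norm_pow, Complex.norm_real, Real.norm_of_nonneg (Real.exp_nonneg _)]
  have hi : Integrable fun z : ℂ => h z ^ 2 * (Real.exp (-‖z‖ ^ 2) : ℂ) := by
    refine (integrable_norm_iff ?_).1 (by simpa only [hn] using hh.2)
    have := hd.continuous
    exact Continuous.aestronglyMeasurable (by fun_prop)
  have h1 := integral_mul_gaussian_eq (G := fun z => h z ^ 2) (by fun_prop) hi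
  have h2 := norm_integral_le_integral_norm (μ := volume)
    fun z : ℂ => h z ^ 2 * (Real.exp (-‖z‖ ^ 2) : ℂ)
  simp only [hn] at h2
  rw [h1, norm_mul, norm_pow, Complex.norm_real, Real.norm_of_nonneg Real.pi_pos.le] at h2
  rw [fockNormSq, one_div, inv_mul_eq_div, le_div_iff₀ Real.pi_pos]
  linarith

/-- Sharp pointwise estimate in the Fock space. -/
theorem norm_apply_sq_le {h : ℂ → ℂ} (hh : MemFock h) (w : ℂ) :
    ‖h w‖ ^ 2 ≤ Real.exp (‖w‖ ^ 2) * fockNormSq h := by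
  have := norm_apply_zero_sq_le (hh.weylShift w)
  rw [fockNormSq_weylShift] at this
  simpa [weylShift] using this

theorem norm_apply_le {h : ℂ → ℂ} (hh : MemFock h) (w : ℂ) :
    ‖h w‖ ≤ Real.exp (‖w‖ ^ 2) * fockNorm h := by
  refine abs_le_of_sq_le_sq' ?_ (mul_nonneg (Real.exp_nonneg _) (fockNorm_nonneg h)) |>.2
  rw [mul_pow, fockNorm_sq]
  refine (norm_apply_sq_le hh w).trans ?_
  have := fockNormSq_nonneg h
  gcongr
  exact le_self_pow₀ (Real.one_le_exp (by positivity)) two_ne_zero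

theorem norm_deriv_le {h : ℂ → ℂ} (hh : MemFock h) (p : ℂ) :
    ‖deriv h p‖ ≤ Real.exp ((‖p‖ + 1) ^ 2) * fockNorm h := by
  have := Complex.norm_deriv_le_of_forall_mem_sphere_norm_le (c := p) (f := h) one_pos
    hh.1.diffContOnCl (C := Real.exp ((‖p‖ + 1) ^ 2) * fockNorm h) ?_
  · simpa using this
  · intro z hz
    refine (norm_apply_le hh z).trans ?_
    have hz' : ‖z‖ ≤ ‖p‖ + 1 := by
      have := norm_sub_norm_le z p
      rw [mem_sphere_iff_norm] at hz
      linarith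
    have := fockNorm_nonneg h
    gcongr

theorem fockKernel_eq_weylShift (w : ℂ) : fockKernel w = weylShift (-w) fun _ => 1 := by
  ext z
  simp [fockKernel, weylShift]

theorem memFock_fockKernel (w : ℂ) : MemFock (fockKernel w) := by
  rw [fockKernel_eq_weylShift]
  exact memFock_one.weylShift _

theorem fockNormSq_fockKernel (w : ℂ) : fockNormSq (fockKernel w) = Real.exp (‖w‖ ^ 2) := by
  rw [fockKernel_eq_weylShift, fockNormSq_weylShift, fockNormSq_one, norm_neg, mul_one]

theorem MemFock.iterate {T : (ℂ → ℂ) → ℂ → ℂ} (hT : ∀ f, MemFock f → MemFock (T f))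
    {f : ℂ → ℂ} (hf : MemFock f) (n : ℕ) : MemFock (T^[n] f) := by
  induction n with
  | zero => exact hf
  | succ n ih =>
    rw [Function.iterate_succ_apply']
    exact hT _ ih

/-- A vector whose projective orbit under `T` is dense in the Fock space. -/
def IsSupercyclicVec (T : (ℂ → ℂ) → ℂ → ℂ) (f : ℂ → ℂ) : Prop :=
  MemFock f ∧ ∀ g, MemFock g → ∀ ε : ℝ, 0 < ε →
    ∃ (lam : ℂ) (n : ℕ), fockNormSq (fun z => lam * T^[n] f z - g z) < ε

theorem IsSupercyclicVec.exists_fockNorm_lt {T : (ℂ → ℂ) → ℂ → ℂ} {f g : ℂ → ℂ}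
    (hf : IsSupercyclicVec T f) (hg : MemFock g) {δ : ℝ} (hδ : 0 < δ) :
    ∃ (lam : ℂ) (n : ℕ), fockNorm (fun z => lam * T^[n] f z - g z) < δ := by
  obtain ⟨lam, n, h⟩ := hf.2 g hg (δ ^ 2) (by positivity)
  exact ⟨lam, n, (Real.sqrt_lt' hδ).2 h⟩

/-- The logarithmic derivatives at any point along a supercyclic orbit are dense in `ℂ`. -/
theorem IsSupercyclicVec.exists_deriv_div_near {T : (ℂ → ℂ) → ℂ → ℂ} {f : ℂ → ℂ}
    (hT : ∀ f, MemFock f → MemFock (T f)) (hf : IsSupercyclicVec T f) (p β : ℂ) {δ : ℝ}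
    (hδ : 0 < δ) :
    ∃ n : ℕ, T^[n] f p ≠ 0 ∧ ‖deriv (T^[n] f) p / T^[n] f p - β‖ < δ := by
  set g : ℂ → ℂ := fun z => Complex.exp (-(β * p)) * fockKernel ((starRingEnd ℂ) β) z with hg
  have hgm : MemFock g := (memFock_fockKernel _).const_mul _
  have hgp : g p = 1 := by
    simp [hg, fockKernel, ← Complex.exp_add, mul_comm]
  have hgd : deriv g p = β := by
    have h1 : HasDerivAt (fun z : ℂ => Complex.exp (-(β * p)) * Complex.exp (z * β))
        (Complex.exp (-(β * p)) * (Complex.exp (p * β) * (1 * β))) p :=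
      (((hasDerivAt_id p).mul_const β).cexp).const_mul _
    have h2 : g = fun z : ℂ => Complex.exp (-(β * p)) * Complex.exp (z * β) := by
      simp [hg, fockKernel]
    rw [h2, h1.deriv, ← mul_assoc, ← Complex.exp_add]
    simp [mul_comm]
  set M : ℝ := Real.exp (‖p‖ ^ 2) with hM
  set M' : ℝ := Real.exp ((‖p‖ + 1) ^ 2) with hM'
  have hM0 : 0 < M := Real.exp_pos _
  have hM'0 : 0 < M' := Real.exp_pos _
  set K : ℝ := M' + ‖β‖ * M with hK
  have hK0 : 0 < K := by positivity
  obtain ⟨lam, n, hlt⟩ := hf.exists_fockNorm_lt hgm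
    (δ := min (1 / (2 * M)) (δ / (2 * K))) (by positivity)
  have hFm : MemFock (T^[n] f) := hf.1.iterate hT n
  set F := T^[n] f
  set h : ℂ → ℂ := fun z => lam * F z - g z with hh
  have hhm : MemFock h := (hFm.const_mul lam).sub hgm
  have hd : deriv h p = lam * deriv F p - β := by
    rw [← hgd]
    exact (((hFm.1 p).hasDerivAt.const_mul lam).sub (hgm.1 p).hasDerivAt).deriv
  have hp : h p = lam * F p - 1 := by rw [← hgp]
  have h1 : ‖lam * F p - 1‖ < 1 / 2 := by
    rw [← hp]
    calc ‖h p‖ ≤ M * fockNorm h := norm_apply_le hhm p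
      _ < M * (1 / (2 * M)) := by
        gcongr
        exact hlt.trans_le (min_le_left _ _)
      _ = 1 / 2 := by field_simp
  have h2 : ‖lam * deriv F p - β * (lam * F p)‖ < δ / 2 := by
    have he : lam * deriv F p - β * (lam * F p) = deriv h p - β * h p := by
      rw [hd, hp]
      ring
    rw [he]
    calc ‖deriv h p - β * h p‖ ≤ ‖deriv h p‖ + ‖β * h p‖ := norm_sub_le _ _
      _ ≤ M' * fockNorm h + ‖β‖ * (M * fockNorm h) := by
        rw [norm_mul]
        gcongr
        · exact norm_deriv_le hhm p
        · exact norm_apply_le hhm p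
      _ = K * fockNorm h := by ring
      _ < K * (δ / (2 * K)) := by
        gcongr
        exact hlt.trans_le (min_le_right _ _)
      _ = δ / 2 := by field_simp
  have h3 : 1 / 2 < ‖lam * F p‖ := by
    have := norm_sub_norm_le 1 (1 - lam * F p)
    rw [norm_one, sub_sub_cancel, norm_sub_rev] at this
    linarith
  have h4 : lam * F p ≠ 0 := norm_pos_iff.1 (by linarith)
  have hl := left_ne_zero_of_mul h4
  have hF := right_ne_zero_of_mul h4
  refine ⟨n, hF, ?_⟩
  have he : deriv F p / F p - β = (lam * deriv F p - β * (lam * F p)) / (lam * F p) := by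
    field_simp
  rw [he, norm_div, div_lt_iff₀ (by linarith)]
  nlinarith

/-- The weight of a supercyclic weighted composition operator has no zeros. -/
theorem IsSupercyclicVec.weight_ne_zero {u ψ f : ℂ → ℂ}
    (hT : ∀ f, MemFock f → MemFock (wComp u ψ f)) (hf : IsSupercyclicVec (wComp u ψ) f) (p : ℂ) :
    u p ≠ 0 := by
  intro hup
  obtain ⟨n, hn, h⟩ := hf.exists_deriv_div_near hT p (deriv f p / f p + 1) one_pos
  cases n with
  | zero => simp at h
  | succ n =>
    rw [Function.iterate_succ_apply'] at hn
    simp [wComp, hup] at hn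

/-- The orbits of an affine map of `ℂ` are not dense. -/
theorem exists_forall_le_norm_affine_orbit_sub {a d : ℂ} {r : ℕ → ℂ}
    (hr : ∀ n, r (n + 1) = d + a * r n) : ∃ β : ℂ, ∃ δ > 0, ∀ n, δ ≤ ‖r n - β‖ := by
  by_cases ha : a = 1
  · have h : ∀ n : ℕ, r n = r 0 + n * d := by
      intro n
      induction n with
      | zero => simp
      | succ n ih =>
        rw [hr, ih, ha]
        push_cast
        ring
    by_cases hd : d = 0
    · exact ⟨r 0 + 1, 1, one_pos, fun n => by simp [h n, hd]⟩
    · refine ⟨r 0 + Complex.I * d, ‖d‖, norm_pos_iff.2 hd, fun n => ?_⟩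
      have he : r n - (r 0 + Complex.I * d) = (n - Complex.I) * d := by
        rw [h n]
        ring
      rw [he, norm_mul]
      refine le_mul_of_one_le_left (norm_nonneg d) ?_
      simpa using Complex.abs_im_le_norm ((n : ℂ) - Complex.I)
  · have ha' : 1 - a ≠ 0 := sub_ne_zero.2 (Ne.symm ha)
    set q := d / (1 - a) with hq
    have hq' : d = q - a * q := by
      rw [hq]
      field_simp
    have h : ∀ n : ℕ, r n - q = a ^ n * (r 0 - q) := by
      intro n
      induction n with
      | zero => simp
      | succ n ih =>
        rw [hr, hq', pow_succ']
        linear_combination a * ih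
    rcases le_or_gt ‖a‖ 1 with h1 | h1
    · refine ⟨q + (‖r 0 - q‖ + 1 : ℝ), 1, one_pos, fun n => ?_⟩
      have h2 : ‖r n - q‖ ≤ ‖r 0 - q‖ := by
        rw [h, norm_mul, norm_pow]
        exact mul_le_of_le_one_left (norm_nonneg _) (pow_le_one₀ (norm_nonneg _) h1)
      have h3 := norm_sub_norm_le ((‖r 0 - q‖ + 1 : ℝ) : ℂ) (r n - q)
      rw [Complex.norm_real, Real.norm_of_nonneg (by positivity), norm_sub_rev _ (r n - q)] at h3
      rw [← sub_sub]
      linarith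
    · by_cases h0 : r 0 = q
      · refine ⟨q + 1, 1, one_pos, fun n => ?_⟩
        have := h n
        rw [h0, sub_self, mul_zero] at this
        simp [sub_eq_zero.1 this]
      · refine ⟨q, ‖r 0 - q‖, norm_pos_iff.2 (sub_ne_zero.2 h0), fun n => ?_⟩
        rw [h n, norm_mul, norm_pow]
        exact le_mul_of_one_le_left (norm_nonneg _) (one_le_pow₀ h1.le)

/-- The symbol of a supercyclic weighted composition operator has no fixed points. -/
theorem IsSupercyclicVec.symbol_ne_self {u ψ f : ℂ → ℂ} (hu : Differentiable ℂ u)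
    (hψ : Differentiable ℂ ψ) (hT : ∀ f, MemFock f → MemFock (wComp u ψ f))
    (hf : IsSupercyclicVec (wComp u ψ) f) (p : ℂ) : ψ p ≠ p := by
  intro hp
  have hup := hf.weight_ne_zero hT p
  set T := wComp u ψ with hTdef
  have hval : ∀ n, T^[n + 1] f p = u p * T^[n] f p := by
    intro n
    rw [Function.iterate_succ_apply', hTdef, wComp, hp]
  have hfp : f p ≠ 0 := by
    intro h0
    obtain ⟨n, hn, -⟩ := hf.exists_deriv_div_near hT p 0 one_pos
    refine hn ?_
    clear hn
    induction n with
    | zero => exact h0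
    | succ n ih => rw [hval, ih, mul_zero]
  have hne : ∀ n, T^[n] f p ≠ 0 := by
    intro n
    induction n with
    | zero => exact hfp
    | succ n ih =>
      rw [hval]
      exact mul_ne_zero hup ih
  have hder : ∀ n, deriv (T^[n + 1] f) p =
      deriv u p * T^[n] f p + u p * (deriv ψ p * deriv (T^[n] f) p) := by
    intro n
    rw [Function.iterate_succ_apply']
    have hF := (hf.1.iterate hT n).1
    set F := T^[n] f
    have h1 : HasDerivAt F (deriv F p) (ψ p) := by
      rw [hp]
      exact (hF p).hasDerivAt
    have h2 := (hu p).hasDerivAt.mul (h1.comp p (hψ p).hasDerivAt)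
    have h3 := h2.deriv
    simp only [Function.comp, hp] at h3
    rw [mul_comm (deriv ψ p), ← h3]
    rfl
  obtain ⟨β, δ, hδ, hfar⟩ := exists_forall_le_norm_affine_orbit_sub
    (r := fun n => deriv (T^[n] f) p / T^[n] f p) (a := deriv ψ p) (d := deriv u p / u p) (by
      intro n
      have := hne n
      simp only [hval, hder]
      field_simp)
  obtain ⟨n, -, hn⟩ := hf.exists_deriv_div_near hT p β hδ
  exact absurd hn (not_lt.2 (hfar n))

/-- Testing boundedness on reproducing kernels. -/
theorem norm_weight_sq_mul_exp_le {u ψ : ℂ → ℂ} {C : ℝ}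
    (hT : ∀ f, MemFock f → MemFock (wComp u ψ f))
    (hb : ∀ f, MemFock f → fockNormSq (wComp u ψ f) ≤ C * fockNormSq f) (w : ℂ) :
    ‖u w‖ ^ 2 * Real.exp (‖ψ w‖ ^ 2) ≤ C * Real.exp (‖w‖ ^ 2) := by
  have hk := memFock_fockKernel (ψ w)
  have h1 := norm_apply_sq_le (hT _ hk) w
  have h2 := hb _ hk
  rw [fockNormSq_fockKernel] at h2
  have h3 : ‖wComp u ψ (fockKernel (ψ w)) w‖ ^ 2 =
      ‖u w‖ ^ 2 * Real.exp (‖ψ w‖ ^ 2) * Real.exp (‖ψ w‖ ^ 2) := by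
    rw [wComp, fockKernel, norm_mul, mul_pow, Complex.norm_exp, Complex.mul_conj,
      Complex.ofReal_re, Complex.normSq_eq_norm_sq]
    ring
  rw [h3] at h1
  have h4 : ‖u w‖ ^ 2 * Real.exp (‖ψ w‖ ^ 2) * Real.exp (‖ψ w‖ ^ 2) ≤
      C * Real.exp (‖w‖ ^ 2) * Real.exp (‖ψ w‖ ^ 2) := by
    refine h1.trans ?_
    rw [mul_right_comm, mul_comm _ (Real.exp (‖w‖ ^ 2))]
    gcongr
  exact le_of_mul_le_mul_right h4 (Real.exp_pos _)

theorem pow_le_sqrt_pow_mul_exp {n : ℕ} (hn : n ≠ 0) {t : ℝ} (ht : 0 ≤ t) :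
    t ^ n ≤ √n ^ n * Real.exp (t ^ 2 / 4) := by
  have hn' : (0 : ℝ) < n := by positivity
  set r := √(n : ℝ) with hr
  have hr0 : 0 < r := Real.sqrt_pos.2 hn'
  have hr2 : r ^ 2 = n := Real.sq_sqrt hn'.le
  have h1 : t / r ≤ Real.exp ((t / r) ^ 2 / 4) := by
    have := Real.add_one_le_exp ((t / r) ^ 2 / 4)
    nlinarith [sq_nonneg (t / r / 2 - 1)]
  have h2 : (t / r) ^ n ≤ Real.exp (t ^ 2 / 4) := by
    calc (t / r) ^ n ≤ Real.exp ((t / r) ^ 2 / 4) ^ n := by gcongr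
      _ = Real.exp (t ^ 2 / 4) := by
        rw [← Real.exp_nat_mul, div_pow, hr2]
        congr 1
        field_simp
  rwa [div_pow, div_le_iff₀' (by positivity)] at h2

theorem norm_deriv_symbol_le {u ψ : ℂ → ℂ} {C : ℝ} (hu : Differentiable ℂ u)
    (hψ : Differentiable ℂ ψ)
    (hg : ∀ w, ‖u w‖ ^ 2 * Real.exp (‖ψ w‖ ^ 2) ≤ C * Real.exp (‖w‖ ^ 2)) {p : ℂ}
    (hp : u p ≠ 0) : ‖deriv ψ p‖ ≤ Real.exp 1 := by
  set g := dslope ψ p with hgdef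
  have hgd : Differentiable ℂ g := by
    rw [← differentiableOn_univ] at hψ ⊢
    exact (Complex.differentiableOn_dslope Filter.univ_mem).2 hψ
  set B : ℝ := √C * Real.exp (‖p‖ ^ 2 + ‖ψ p‖ ^ 2 / 2) with hB
  have key : ∀ n : ℕ, n ≠ 0 → ‖u p‖ * ‖deriv ψ p‖ ^ n ≤ B * Real.exp 1 ^ n := by
    intro n hn
    have hn' : (0 : ℝ) < n := by positivity
    have hr0 : 0 < √(n : ℝ) := Real.sqrt_pos.2 hn'
    have hr2 : √(n : ℝ) ^ 2 = n := Real.sq_sqrt hn'.le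
    have := Complex.norm_le_of_forall_mem_frontier_norm_le (f := fun z => u z * g z ^ n)
      (Metric.isBounded_ball (x := p) (r := √(n : ℝ))) (Differentiable.diffContOnCl (by fun_prop))
      (C := B * Real.exp 1 ^ n) ?_ (z := p) (subset_closure (Metric.mem_ball_self hr0))
    · simpa [hgdef] using this
    · intro z hz
      rw [frontier_ball p hr0.ne', mem_sphere_iff_norm] at hz
      have hzp : z ≠ p := by
        rintro rfl
        simp at hz
        exact hr0.ne hz
      have hgz : ‖g z‖ ^ n = ‖ψ z - ψ p‖ ^ n / √(n : ℝ) ^ n := by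
        rw [hgdef, dslope_of_ne _ hzp, slope_def_field, norm_div, hz, div_pow]
      have huz : ‖u z‖ ≤ √C * Real.exp ((‖z‖ ^ 2 - ‖ψ z‖ ^ 2) / 2) := by
        have h1 : ‖u z‖ ^ 2 ≤ C * Real.exp (‖z‖ ^ 2 - ‖ψ z‖ ^ 2) := by
          rw [Real.exp_sub, ← mul_div_assoc, le_div_iff₀ (Real.exp_pos _)]
          exact hg z
        rw [Real.exp_half, ← Real.sqrt_mul' _ (Real.exp_nonneg _)]
        exact Real.le_sqrt_of_sq_le h1
      have hz2 : ‖z‖ ^ 2 ≤ 2 * n + 2 * ‖p‖ ^ 2 := by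
        have h1 : ‖z‖ ≤ √(n : ℝ) + ‖p‖ := by
          have := norm_sub_norm_le z p
          linarith
        rw [← hr2]
        nlinarith [norm_nonneg z, sq_nonneg (√(n : ℝ) - ‖p‖)]
      have ht2 : ‖ψ z - ψ p‖ ^ 2 ≤ 2 * ‖ψ z‖ ^ 2 + 2 * ‖ψ p‖ ^ 2 := by
        have h1 := norm_sub_le (ψ z) (ψ p)
        nlinarith [norm_nonneg (ψ z - ψ p), sq_nonneg (‖ψ z‖ - ‖ψ p‖)]
      have ht := pow_le_sqrt_pow_mul_exp hn (norm_nonneg (ψ z - ψ p))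
      rw [norm_mul, norm_pow, hgz]
      calc ‖u z‖ * (‖ψ z - ψ p‖ ^ n / √(n : ℝ) ^ n)
          ≤ √C * Real.exp ((‖z‖ ^ 2 - ‖ψ z‖ ^ 2) / 2) * Real.exp (‖ψ z - ψ p‖ ^ 2 / 4) := by
            gcongr
            rwa [div_le_iff₀' (by positivity)]
        _ = √C * Real.exp ((‖z‖ ^ 2 - ‖ψ z‖ ^ 2) / 2 + ‖ψ z - ψ p‖ ^ 2 / 4) := by
            rw [mul_assoc, ← Real.exp_add]
        _ ≤ √C * Real.exp (‖p‖ ^ 2 + ‖ψ p‖ ^ 2 / 2 + n * 1) := by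
            refine mul_le_mul_of_nonneg_left (Real.exp_le_exp.2 ?_) (Real.sqrt_nonneg C)
            linarith
        _ = B * Real.exp 1 ^ n := by rw [Real.exp_add, Real.exp_nat_mul, hB, mul_assoc]
  by_contra! hlt
  have hup : 0 < ‖u p‖ := norm_pos_iff.2 hp
  obtain ⟨n, hn⟩ := pow_unbounded_of_one_lt (max 1 (B / ‖u p‖))
    ((one_lt_div (Real.exp_pos 1)).2 hlt)
  have hn0 : n ≠ 0 := by
    rintro rfl
    simp at hn
  have h1 := (le_max_right _ _).trans_lt hn
  rw [div_pow, div_lt_div_iff₀ hup (by positivity)] at h1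
  linarith [key n hn0]

theorem eq_add_const_of_norm_deriv_le {ψ : ℂ → ℂ} (hψ : Differentiable ℂ ψ) {A : ℝ}
    (hA : ∀ z, ‖deriv ψ z‖ ≤ A) (hfix : ∀ z, ψ z ≠ z) : ∃ b ≠ 0, ∀ z, ψ z = z + b := by
  have hd : Differentiable ℂ (deriv ψ) := by
    rw [← differentiableOn_univ] at hψ ⊢
    exact hψ.deriv isOpen_univ
  have hconst : ∀ z, deriv ψ z = deriv ψ 0 := fun z =>
    hd.apply_eq_apply_of_bounded (isBounded_iff_forall_norm_le.2
      ⟨A, by rintro _ ⟨z, rfl⟩; exact hA z⟩) z 0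
  set a := deriv ψ 0 with ha
  have haff : ∀ z, ψ z = a * z + ψ 0 := by
    intro z
    have := is_const_of_deriv_eq_zero (f := fun z => ψ z - a * z) (by fun_prop) (fun x => by
      have h := ((hψ x).hasDerivAt.sub ((hasDerivAt_id x).const_mul a)).deriv
      rw [hconst, mul_one, sub_self] at h
      exact h) z 0
    simp at this
    linear_combination this
  have ha1 : a = 1 := by
    by_contra hne
    have h1 : 1 - a ≠ 0 := sub_ne_zero.2 (Ne.symm hne)
    apply hfix (ψ 0 / (1 - a))
    rw [haff]
    field_simp
    ring
  exact ⟨ψ 0, hfix 0, fun z => by rw [haff, ha1, one_mul]⟩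

theorem weight_eq_of_symbol_eq_add {u ψ : ℂ → ℂ} {C : ℝ} {b : ℂ} (hu : Differentiable ℂ u)
    (hg : ∀ w, ‖u w‖ ^ 2 * Real.exp (‖ψ w‖ ^ 2) ≤ C * Real.exp (‖w‖ ^ 2))
    (hψ : ∀ z, ψ z = z + b) (z : ℂ) :
    u z = u 0 * Complex.exp (-(z * (starRingEnd ℂ) b)) := by
  have hbd : ∀ w, ‖u w * Complex.exp (w * (starRingEnd ℂ) b)‖ ≤ √C := by
    intro w
    apply Real.le_sqrt_of_sq_le
    have hn : ‖w + b‖ ^ 2 = ‖w‖ ^ 2 + ‖b‖ ^ 2 + 2 * (w * (starRingEnd ℂ) b).re := by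
      simp only [← Complex.normSq_eq_norm_sq, Complex.normSq_add]
    have h := hg w
    rw [hψ, hn, add_assoc, Real.exp_add, ← mul_assoc, mul_right_comm] at h
    have h1 := le_of_mul_le_mul_right h (Real.exp_pos _)
    rw [norm_mul, mul_pow, Complex.norm_exp, ← Real.exp_nat_mul]
    refine le_trans ?_ h1
    gcongr
    push_cast
    linarith [sq_nonneg ‖b‖]
  have h := Differentiable.apply_eq_apply_of_bounded
    (f := fun w => u w * Complex.exp (w * (starRingEnd ℂ) b)) (by fun_prop)
    (isBounded_iff_forall_norm_le.2 ⟨√C, by rintro _ ⟨w, rfl⟩; exact hbd w⟩) z 0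
  simp only [zero_mul, Complex.exp_zero, mul_one] at h
  rw [← h, mul_assoc, ← Complex.exp_add]
  simp

theorem abs_fockNorm_sub_le {f g : ℂ → ℂ} (hf : MemFock f) (hg : MemFock g) :
    |fockNorm f - fockNorm g| ≤ fockNorm (fun z => f z - g z) := by
  have h1 := fockNorm_add_le (hf.sub hg) hg
  have h2 := fockNorm_sub_le hf (hf.sub hg)
  simp only [sub_add_cancel, sub_sub_cancel] at h1 h2
  rw [abs_le]
  constructor <;> linarith

theorem weylShift_const_mul (b c : ℂ) (h : ℂ → ℂ) :
    weylShift b (fun z => c * h z) = fun z => c * weylShift b h z := by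
  ext z
  simp only [weylShift]
  ring

theorem weylShift_sub (b : ℂ) (f g : ℂ → ℂ) :
    weylShift b (fun z => f z - g z) = fun z => weylShift b f z - weylShift b g z := by
  ext z
  simp only [weylShift]
  ring

theorem fockNorm_weylShift (b : ℂ) (h : ℂ → ℂ) :
    fockNorm (weylShift b h) = √(Real.exp (‖b‖ ^ 2)) * fockNorm h := by
  rw [fockNorm, fockNormSq_weylShift, Real.sqrt_mul (Real.exp_nonneg _), fockNorm]

/-- How far the Weyl translation by `b` moves `h`. -/
noncomputable def weylDefect (b : ℂ) (h : ℂ → ℂ) : ℂ → ℂ :=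
  fun z => weylShift b h z - h z

theorem MemFock.weylDefect {h : ℂ → ℂ} (hh : MemFock h) (b : ℂ) : MemFock (weylDefect b h) :=
  (hh.weylShift b).sub hh

theorem abs_fockNorm_weylDefect_sub_le {f g : ℂ → ℂ} (b : ℂ) (hf : MemFock f) (hg : MemFock g) :
    |fockNorm (weylDefect b f) - fockNorm (weylDefect b g)| ≤
      (√(Real.exp (‖b‖ ^ 2)) + 1) * fockNorm (fun z => f z - g z) := by
  refine (abs_fockNorm_sub_le (hf.weylDefect b) (hg.weylDefect b)).trans ?_
  have h := fockNorm_sub_le ((hf.sub hg).weylShift b) (hf.sub hg)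
  rw [fockNorm_weylShift, weylShift_sub] at h
  have e : (fun z => weylDefect b f z - weylDefect b g z) =
      fun z => weylShift b f z - weylShift b g z - (f z - g z) := by
    ext z
    simp only [weylDefect]
    ring
  rw [add_mul, one_mul, e]
  exact h

theorem fockNorm_mul_weylDefect_iterate {T : (ℂ → ℂ) → ℂ → ℂ} {b c : ℂ}
    (hT : ∀ h, T h = fun z => c * weylShift b h z) (f : ℂ → ℂ) (n : ℕ) :
    fockNorm f * fockNorm (weylDefect b (T^[n] f)) =
      fockNorm (weylDefect b f) * fockNorm (T^[n] f) := by
  have hdef : ∀ h, weylDefect b (T h) = T (weylDefect b h) := by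
    intro h
    have e1 : weylDefect b h = fun z => weylShift b h z - h z := rfl
    rw [e1, hT, hT, weylShift_sub]
    ext z
    simp only [weylDefect, weylShift_const_mul]
    ring
  have hnorm : ∀ h, fockNorm (T h) = ‖c‖ * √(Real.exp (‖b‖ ^ 2)) * fockNorm h := by
    intro h
    rw [hT, fockNorm_const_mul, fockNorm_weylShift, mul_assoc]
  induction n with
  | zero => exact mul_comm _ _
  | succ n ih =>
    rw [Function.iterate_succ_apply', hdef, hnorm, hnorm, mul_left_comm, ih]
    ring

/-- A supercyclic multiple of a Weyl translation moves all vectors by the same relative amount. -/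
theorem IsSupercyclicVec.fockNorm_mul_weylDefect {T : (ℂ → ℂ) → ℂ → ℂ} {b c : ℂ} {f : ℂ → ℂ}
    (hmem : ∀ f, MemFock f → MemFock (T f))
    (hT : ∀ h, T h = fun z => c * weylShift b h z) (hf : IsSupercyclicVec T f) {x : ℂ → ℂ}
    (hx : MemFock x) :
    fockNorm f * fockNorm (weylDefect b x) = fockNorm (weylDefect b f) * fockNorm x := by
  set K := fockNorm f * (√(Real.exp (‖b‖ ^ 2)) + 1) + fockNorm (weylDefect b f) with hK
  have hf0 := fockNorm_nonneg f
  have hd0 := fockNorm_nonneg (weylDefect b f)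
  have hK0 : 0 ≤ K := by positivity
  rw [← sub_eq_zero, ← abs_nonpos_iff]
  refine le_of_forall_pos_le_add fun ε hε => ?_
  obtain ⟨lam, n, hlt⟩ := hf.exists_fockNorm_lt hx (δ := ε / (K + 1)) (by positivity)
  have hFm := (hf.1.iterate hmem n).const_mul lam
  have hid := fockNorm_mul_weylDefect_iterate hT f n
  have hid' : fockNorm f * fockNorm (weylDefect b fun z => lam * T^[n] f z) =
      fockNorm (weylDefect b f) * fockNorm fun z => lam * T^[n] f z := by
    have e : (weylDefect b fun z => lam * T^[n] f z) =
        fun z => lam * weylDefect b (T^[n] f) z := by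
      ext z
      simp only [weylDefect, weylShift_const_mul]
      ring
    rw [e, fockNorm_const_mul, fockNorm_const_mul, mul_left_comm, hid, mul_left_comm]
  set F : ℂ → ℂ := fun z => lam * T^[n] f z
  have h1 := abs_fockNorm_weylDefect_sub_le b hFm hx
  have h2 := abs_fockNorm_sub_le hFm hx
  set d := fockNorm fun z => F z - x z with hd
  have e : fockNorm f * fockNorm (weylDefect b x) - fockNorm (weylDefect b f) * fockNorm x =
      fockNorm (weylDefect b f) * (fockNorm F - fockNorm x) -
        fockNorm f * (fockNorm (weylDefect b F) - fockNorm (weylDefect b x)) := by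
    linear_combination hid'
  rw [e, zero_add]
  calc _ ≤ |fockNorm (weylDefect b f) * (fockNorm F - fockNorm x)| +
        |fockNorm f * (fockNorm (weylDefect b F) - fockNorm (weylDefect b x))| := abs_sub _ _
    _ ≤ fockNorm (weylDefect b f) * d + fockNorm f * ((√(Real.exp (‖b‖ ^ 2)) + 1) * d) := by
      rw [abs_mul, abs_mul, abs_of_nonneg hf0, abs_of_nonneg hd0]
      gcongr
    _ = K * d := by ring
    _ ≤ (K + 1) * (ε / (K + 1)) := by
      have : 0 ≤ d := fockNorm_nonneg _
      gcongr
      linarith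
    _ = ε := by field_simp

theorem fockNormSq_add_one_sub {E : ℂ → ℂ} (hE : MemFock E) :
    fockNormSq (fun z => E z + 1) - fockNormSq (fun z => E z - 1) = 4 * (E 0).re := by
  have hd := hE.1
  have hi : Integrable fun z : ℂ => E z * (Real.exp (-‖z‖ ^ 2) : ℂ) := by
    refine (hE.2.add memFock_one.2).mono' ?_ (.of_forall fun z => ?_)
    · have := hd.continuous
      exact Continuous.aestronglyMeasurable (by fun_prop)
    · rw [norm_mul, Complex.norm_real, Real.norm_of_nonneg (Real.exp_nonneg _), Pi.add_apply,
        ← add_mul]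
      gcongr
      rw [norm_one]
      nlinarith [sq_nonneg (‖E z‖ - 1), norm_nonneg (E z)]
  have h1 := congrArg Complex.re (integral_mul_gaussian_eq hd hi)
  rw [← Complex.reCLM_apply, ← Complex.reCLM.integral_comp_comm hi] at h1
  simp only [Complex.reCLM_apply, Complex.re_mul_ofReal, Complex.re_ofReal_mul] at h1
  have e : ∀ z : ℂ, ‖E z + 1‖ ^ 2 * Real.exp (-‖z‖ ^ 2) - ‖E z - 1‖ ^ 2 * Real.exp (-‖z‖ ^ 2) =
      4 * ((E z).re * Real.exp (-‖z‖ ^ 2)) := by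
    intro z
    have h : ‖E z + 1‖ ^ 2 - ‖E z - 1‖ ^ 2 = 4 * (E z).re := by
      rw [← Complex.normSq_eq_norm_sq, ← Complex.normSq_eq_norm_sq, Complex.normSq_add,
        Complex.normSq_sub]
      simp
      ring
    rw [← sub_mul, h, mul_assoc]
  rw [fockNormSq, fockNormSq, ← mul_sub,
    ← integral_sub (hE.add memFock_one).2 (hE.sub memFock_one).2]
  simp only [e]
  rw [integral_const_mul, h1]
  field_simp

theorem not_isSupercyclicVec_of_weylShift {T : (ℂ → ℂ) → ℂ → ℂ} {b c : ℂ} (hb : b ≠ 0)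
    {f : ℂ → ℂ} (hmem : ∀ f, MemFock f → MemFock (T f))
    (hT : ∀ h, T h = fun z => c * weylShift b h z) (hf : IsSupercyclicVec T f) : False := by
  set E : ℂ → ℂ := weylShift b fun _ => 1 with hE
  have hEm : MemFock E := memFock_one.weylShift b
  set s : ℝ := Real.pi / (2 * ‖b‖ ^ 2) with hs
  set w : ℂ := s * Complex.I * b with hw
  have hb' : (0 : ℝ) < ‖b‖ := norm_pos_iff.2 hb
  have hbb : b * (starRingEnd ℂ) b = ((‖b‖ ^ 2 : ℝ) : ℂ) := by
    rw [Complex.mul_conj, Complex.normSq_eq_norm_sq]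
  have hsb : (s : ℂ) * ((‖b‖ ^ 2 : ℝ) : ℂ) * 2 = Real.pi := by
    rw [hs]
    norm_cast
    field_simp
  have hphase : weylDefect b (weylShift (-w) fun _ => 1) =
      weylShift (-w) fun z => (-1) * (E z + 1) := by
    ext z
    have h1 : Complex.exp (-(z * (starRingEnd ℂ) b)) * Complex.exp ((z + b) * (starRingEnd ℂ) w) =
        -(Complex.exp (z * (starRingEnd ℂ) w) * Complex.exp (-((z + -w) * (starRingEnd ℂ) b))) := by
      have hneg : ∀ x, -Complex.exp x = Complex.exp (x + -(Real.pi * Complex.I)) := fun x => by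
        rw [Complex.exp_add, Complex.exp_neg_pi_mul_I, mul_neg_one]
      rw [← Complex.exp_add, ← Complex.exp_add, hneg]
      congr 1
      simp only [hw, map_mul, Complex.conj_ofReal, Complex.conj_I]
      linear_combination (2 * (-s * Complex.I)) * hbb + (-Complex.I) * hsb
    simp only [weylDefect, weylShift, hE, map_neg, mul_neg, neg_neg, mul_one]
    rw [h1]
    ring
  have h1 := hf.fockNorm_mul_weylDefect hmem hT memFock_one
  have h2 := hf.fockNorm_mul_weylDefect hmem hT (memFock_one.weylShift (-w))
  rw [hphase, fockNorm_weylShift, fockNorm_weylShift, fockNorm_const_mul, norm_neg, norm_neg, norm_one,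
    one_mul, mul_left_comm, mul_left_comm (fockNorm (weylDefect b f)), ← h1] at h2
  have h3 := mul_left_cancel₀ (Real.sqrt_pos.2 (Real.exp_pos _)).ne' h2
  have hfn : fockNorm f ≠ 0 := by
    intro h0
    obtain ⟨n, hn, -⟩ := hf.exists_deriv_div_near hmem 0 0 one_pos
    have hz : ∀ n, fockNorm (T^[n] f) = 0 := by
      intro n
      induction n with
      | zero => exact h0
      | succ n ih =>
        rw [Function.iterate_succ_apply', hT, fockNorm_const_mul, fockNorm_weylShift, ih]
        simp
    have := norm_apply_le (hf.1.iterate hmem n) 0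
    rw [hz, mul_zero] at this
    exact hn (norm_le_zero_iff.1 this)
  have h4 := mul_left_cancel₀ hfn h3
  have h5 := fockNormSq_add_one_sub hEm
  rw [← fockNorm_sq, ← fockNorm_sq, h4] at h5
  change fockNorm (weylDefect b fun _ => 1) ^ 2 - fockNorm (weylDefect b fun _ => 1) ^ 2 = _ at h5
  simp [hE, weylShift] at h5

/-- no bounded weighted composition operator on 𝓕₂ is supercyclic. -/
theorem weighted_composition_not_supercyclic (u ψ : ℂ → ℂ)
    (hu : Differentiable ℂ u) (hψ : Differentiable ℂ ψ)
    (hbdd : FockBoundedOp (wComp u ψ)) :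
    ¬ IsSupercyclicOp (wComp u ψ) := by
  rintro ⟨f, hf : IsSupercyclicVec (wComp u ψ) f⟩
  obtain ⟨hT, C, -, hb⟩ := hbdd
  have hg := norm_weight_sq_mul_exp_le hT hb
  obtain ⟨b, hb0, hψb⟩ := eq_add_const_of_norm_deriv_le hψ
    (fun z => norm_deriv_symbol_le hu hψ hg (hf.weight_ne_zero hT z))
    (hf.symbol_ne_self hu hψ hT)
  refine not_isSupercyclicVec_of_weylShift (c := u 0) hb0 hT (fun h => ?_) hf
  ext z
  rw [wComp, weight_eq_of_symbol_eq_add hu hg hψb z, hψb, weylShift, mul_assoc]
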